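/- Let N ≥ 1 and let Ω ⊂ ℝ^N be a nonempty bounded open set with d(x) = dist(x, Ωᶜ), and assume there exist A > 0 and ε₀ > 0 such that the Lebesgue measure of {x ∈ Ω : d(x) < ε} is at most A·ε for every ε ∈ (0, ε₀]. Let γ : Ω → ℝ be a bounded measurable function such that lim_{d(x)→0} N·γ(x) = L ∈ (0,1), i.e. for every ε > 0 there is δ > 0 with |N·γ(x) − L| < ε for all x ∈ Ω with d(x) < δ. Let C > 0 and let h : Ω → ℝ be measurable with |h(x)| ≤ C·d(x)^{−γ(x)} for all x ∈ Ω. Then h ∈ L^N(Ω), i.e. ∫_Ω |h(x)|^N dx < ∞. -/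

import Mathlib

open MeasureTheory Real Set

noncomputable section

/-- If the sublevel sets `{d < ε}` of a positive function have measure `O(ε)`, then `d ^ (-q)` is
integrable for every `q ∈ (0, 1)`. -/
theorem integrable_rpow_neg_of_measure_lt_le {α : Type*} [MeasurableSpace α] {μ : Measure α}
    [IsFiniteMeasure μ] {d : α → ℝ} (hd : Measurable d) (hpos : ∀ᵐ x ∂μ, 0 < d x)
    {A ε₀ q : ℝ} (hε₀ : 0 < ε₀) (hq : 0 < q) (hq1 : q < 1)
    (hlayer : ∀ ε : ℝ, 0 < ε → ε ≤ ε₀ → μ {x | d x < ε} ≤ ENNReal.ofReal (A * ε)) :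
    Integrable (fun x => d x ^ (-q)) μ := by
  have hm : Measurable (fun x => d x ^ (-q)) := hd.pow_const _
  have hnn : 0 ≤ᵐ[μ] fun x => d x ^ (-q) := by
    filter_upwards [hpos] with x hx using (rpow_pos_of_pos hx _).le
  refine ⟨hm.aestronglyMeasurable, ?_⟩
  rw [hasFiniteIntegral_iff_ofReal hnn, lintegral_eq_lintegral_meas_lt μ hnn hm.aemeasurable]
  have hT : 0 < ε₀ ^ (-q) := rpow_pos_of_pos hε₀ _
  rw [← Ioc_union_Ioi_eq_Ioi hT.le]
  refine (lintegral_union_le _ _ _).trans_lt (ENNReal.add_lt_top.2 ⟨?_, ?_⟩)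
  · calc ∫⁻ t in Ioc 0 (ε₀ ^ (-q)), μ {x | t < d x ^ (-q)}
        ≤ ∫⁻ _ in Ioc 0 (ε₀ ^ (-q)), μ univ := lintegral_mono fun t => measure_mono (subset_univ _)
      _ < ⊤ := by
        rw [setLIntegral_const, Real.volume_Ioc]
        exact ENNReal.mul_lt_top (measure_lt_top _ _) ENNReal.ofReal_lt_top
  · have hexp : -q⁻¹ < -1 := by
      have := (one_lt_inv₀ hq).2 hq1
      linarith
    have hint : IntegrableOn (fun t : ℝ => A * t ^ (-q⁻¹)) (Ioi (ε₀ ^ (-q))) :=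
      (integrableOn_Ioi_rpow_of_lt hexp hT).const_mul A
    refine lt_of_le_of_lt ?_ hint.lintegral_lt_top
    refine setLIntegral_mono' measurableSet_Ioi fun t ht => ?_
    have ht0 : 0 < t := hT.trans ht
    have hsub : μ {x | t < d x ^ (-q)} ≤ μ {x | d x < t ^ (-q⁻¹)} := by
      refine measure_mono_ae ?_
      filter_upwards [hpos] with x hx hxt
      have hxt' : t < d x ^ (-q) := hxt
      have := rpow_lt_rpow_of_neg ht0 hxt' (neg_neg_of_pos (inv_pos.2 hq))
      rwa [← rpow_mul hx.le, neg_mul_neg, mul_inv_cancel₀ hq.ne', rpow_one] at this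
    refine hsub.trans (hlayer _ (rpow_pos_of_pos ht0 _) ?_)
    have := rpow_lt_rpow_of_neg hT ht (neg_neg_of_pos (inv_pos.2 hq))
    rw [← rpow_mul hε₀.le, neg_mul_neg, mul_inv_cancel₀ hq.ne', rpow_one] at this
    exact this.le

theorem rpow_neg_le_exp_of_mem_Icc {d δ D γ B : ℝ} (hδ : 0 < δ) (hd : d ∈ Icc δ D)
    (hγ : |γ| ≤ B) : d ^ (-γ) ≤ exp (max |log δ| |log D| * B) := by
  have hd0 : 0 < d := hδ.trans_le hd.1
  have hlog : |log d| ≤ max |log δ| |log D| :=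
    abs_le_max_abs_abs (log_le_log hδ hd.1) (log_le_log hd0 hd.2)
  rw [rpow_def_of_pos hd0, exp_le_exp]
  calc log d * -γ ≤ |log d * -γ| := le_abs_self _
    _ = |log d| * |γ| := by rw [abs_mul, abs_neg]
    _ ≤ max |log δ| |log D| * B := by gcongr

/-- if |h(x)| ≤ C d(x)^{-γ(x)} with lim_{d(x)→0} N·γ(x) = L ∈ (0,1),
then h ∈ L^N(Ω), i.e. ∫_Ω |h|^N < ∞. Here d(x) = dist(x, Ωᶜ). -/
theorem singular_rhs_in_LN
    (N : ℕ) (hN : 1 ≤ N)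
    (Ω : Set (EuclideanSpace ℝ (Fin N))) (hΩo : IsOpen Ω)
    (hΩb : Bornology.IsBounded Ω) (hΩne : Ω.Nonempty)
    (A ε₀ : ℝ) (hA : 0 < A) (hε₀ : 0 < ε₀)
    (hlayer : ∀ ε : ℝ, 0 < ε → ε ≤ ε₀ →
      volume {x ∈ Ω | Metric.infDist x Ωᶜ < ε} ≤ ENNReal.ofReal (A * ε))
    (γ : EuclideanSpace ℝ (Fin N) → ℝ) (hγmeas : Measurable γ)
    (hγbd : ∃ B : ℝ, ∀ x ∈ Ω, |γ x| ≤ B)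
    (L : ℝ) (hL : L ∈ Set.Ioo (0 : ℝ) 1)
    (hlim : ∀ ε > (0 : ℝ), ∃ δ > (0 : ℝ), ∀ x ∈ Ω,
      Metric.infDist x Ωᶜ < δ → |(N : ℝ) * γ x - L| < ε)
    (C : ℝ) (hC : 0 < C)
    (h : EuclideanSpace ℝ (Fin N) → ℝ) (hmeas : Measurable h)
    (hbd : ∀ x ∈ Ω, |h x| ≤ C * Metric.infDist x Ωᶜ ^ (-(γ x))) :
    IntegrableOn (fun x => |h x| ^ (N : ℝ)) Ω volume := by
  have hNpos : (0 : ℝ) < N := by exact_mod_cast hN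
  have : Nonempty (Fin N) := ⟨⟨0, hN⟩⟩
  have hne : (Ωᶜ).Nonempty := by
    rw [nonempty_compl]
    rintro rfl
    exact NormedSpace.unbounded_univ ℝ (EuclideanSpace ℝ (Fin N)) hΩb
  have hdpos : ∀ x ∈ Ω, 0 < Metric.infDist x Ωᶜ := fun x hx =>
    (hΩo.isClosed_compl.notMem_iff_infDist_pos hne).1 fun hx' => hx' hx
  obtain ⟨D, hD⟩ : ∃ D, ∀ x ∈ Ω, Metric.infDist x Ωᶜ ≤ D := by
    obtain ⟨D, hD⟩ := hΩb.isCompact_closure.bddAbove_image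
      (Metric.continuous_infDist_pt Ωᶜ).continuousOn
    exact ⟨D, fun x hx => hD ⟨x, subset_closure hx, rfl⟩⟩
  obtain ⟨B, hB⟩ := hγbd
  obtain ⟨hL0, hL1⟩ := hL
  obtain ⟨δ, hδ, hδγ⟩ := hlim ((1 - L) / 2) (by linarith)
  have : IsFiniteMeasure (volume.restrict Ω) := ⟨by simpa using hΩb.measure_lt_top⟩
  have hdm : Measurable fun x : EuclideanSpace ℝ (Fin N) => Metric.infDist x Ωᶜ :=
    measurable_infDist
  have hint : Integrable (fun x => Metric.infDist x Ωᶜ ^ (-((1 + L) / 2))) (volume.restrict Ω) := by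
    refine integrable_rpow_neg_of_measure_lt_le hdm
      ((ae_restrict_iff' hΩo.measurableSet).2 (.of_forall hdpos)) (A := A) hε₀
      (by linarith) (by linarith) fun ε h0 h1 => ?_
    rw [Measure.restrict_apply (measurableSet_lt hdm measurable_const), inter_comm]
    exact hlayer ε h0 h1
  set δ' := min δ 1
  have hδ' : 0 < δ' := lt_min hδ one_pos
  set K := exp (max |log δ'| |log D| * B)
  refine ((hint.const_mul (C ^ (N : ℝ))).add (integrable_const ((C * K) ^ (N : ℝ)))).mono'
    (hmeas.abs.pow_const _).aestronglyMeasurable ?_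
  refine (ae_restrict_iff' hΩo.measurableSet).2 (.of_forall fun x hx => ?_)
  have hd0 := hdpos x hx
  rw [norm_of_nonneg (by positivity), Pi.add_apply]
  rcases lt_or_ge (Metric.infDist x Ωᶜ) δ' with hlt | hge
  · refine le_add_of_le_of_nonneg ?_ (by positivity)
    calc |h x| ^ (N : ℝ) ≤ (C * Metric.infDist x Ωᶜ ^ (-(γ x))) ^ (N : ℝ) :=
          rpow_le_rpow (abs_nonneg _) (hbd x hx) hNpos.le
      _ = C ^ (N : ℝ) * Metric.infDist x Ωᶜ ^ (-(γ x) * N) := by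
          rw [mul_rpow hC.le (by positivity), ← rpow_mul hd0.le]
      _ ≤ C ^ (N : ℝ) * Metric.infDist x Ωᶜ ^ (-((1 + L) / 2)) := by
          refine mul_le_mul_of_nonneg_left (rpow_le_rpow_of_exponent_ge hd0
            (hlt.le.trans (min_le_right _ _)) ?_) (by positivity)
          have := (abs_lt.1 (hδγ x hx (hlt.trans_le (min_le_left _ _)))).2
          linarith
  · refine le_add_of_nonneg_of_le (by positivity) ?_
    refine rpow_le_rpow (abs_nonneg _) ((hbd x hx).trans ?_) hNpos.le
    exact mul_le_mul_of_nonneg_left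
      (rpow_neg_le_exp_of_mem_Icc hδ' ⟨hge, hD x hx⟩ (hB x hx)) hC.le
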